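/- Let x and y be strings, each split into k consecutive blocks x = x_1 ⧺ ⋯ ⧺ x_k and y = y_1 ⧺ ⋯ ⧺ y_k. Then for every block sequence S ⊆ [k]×[k], Σ_{(i,j)∈S} L(x_i,y_j) ≤ L(x,y); that is, concatenating common subsequences of the blocks along a block sequence yields a common subsequence of x and y. -/

import Mathlib

/-- The number of matching pairs of strings `x` and `y`: index pairs `(i,j)` with `x[i] = y[j]`. -/
def mp {α : Type*} [DecidableEq α] (x y : List α) : ℕ :=
  (x.product y).countP fun p => decide (p.1 = p.2)

/-- The length of the longest common subsequence of `x` and `y`. -/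
noncomputable def lcs {α : Type*} (x y : List α) : ℕ :=
  sSup {n : ℕ | ∃ z : List α, z.length = n ∧ z.Sublist x ∧ z.Sublist y}

/-- A block sequence: a set of index pairs that is strictly increasing in both coordinates. -/
def BlockSeq {k : ℕ} (S : Finset (Fin k × Fin k)) : Prop :=
  ∀ p ∈ S, ∀ q ∈ S, p ≠ q → (p.1 < q.1 ∧ p.2 < q.2) ∨ (q.1 < p.1 ∧ q.2 < p.2)

theorem lcs_bdd {α : Type*} (x y : List α) :
    BddAbove {n : ℕ | ∃ z : List α, z.length = n ∧ z.Sublist x ∧ z.Sublist y} := by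
  refine ⟨x.length, ?_⟩
  rintro n ⟨z, rfl, h, -⟩
  exact h.length_le

theorem lcs_exists {α : Type*} (x y : List α) :
    ∃ z : List α, z.length = lcs x y ∧ z.Sublist x ∧ z.Sublist y :=
  Nat.sSup_mem (s := {n : ℕ | ∃ z : List α, z.length = n ∧ z.Sublist x ∧ z.Sublist y})
    ⟨0, [], rfl, List.nil_sublist _, List.nil_sublist _⟩ (lcs_bdd x y)

theorem blockSeq_list {k : ℕ} (S : Finset (Fin k × Fin k)) : BlockSeq S →
    ∃ l : List (Fin k × Fin k), (∀ p, p ∈ l ↔ p ∈ S) ∧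
      l.Pairwise (fun p q => p.1 < q.1 ∧ p.2 < q.2) ∧
      ∀ g : Fin k × Fin k → ℕ, ∑ p ∈ S, g p = (l.map g).sum := by
  classical
  induction S using Finset.induction_on_max_value (fun p : Fin k × Fin k => p.1) with
  | empty => intro _; exact ⟨[], by simp⟩
  | insert a s ha hmax ih =>
    intro hS
    obtain ⟨l, h1, h2, h3⟩ := ih (fun p hp q hq => hS p (Finset.mem_insert_of_mem hp) q
      (Finset.mem_insert_of_mem hq))
    refine ⟨l ++ [a], ?_, ?_, ?_⟩
    · intro p; simp [h1, or_comm]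
    · rw [List.pairwise_append]
      refine ⟨h2, by simp, ?_⟩
      intro p hp q hq
      obtain rfl : q = a := by simpa using hq
      have hp' := (h1 p).1 hp
      rcases hS p (Finset.mem_insert_of_mem hp') q (Finset.mem_insert_self _ _)
        (by rintro rfl; exact ha hp') with h | h
      · exact h
      · exact absurd h.1 (not_lt.2 (hmax p hp'))
    · intro g
      rw [Finset.sum_insert ha, h3]; simp [add_comm]

theorem flatten_map_sub {α β : Type*} (l : List β) (f g : β → List α)
    (h : ∀ b, (f b).Sublist (g b)) : ((l.map f).flatten).Sublist (l.map g).flatten := by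
  induction l with
  | nil => simp
  | cons a l ih => simpa using (h a).append ih

theorem sub_blocks {α β : Type*} {k : ℕ} (l : List β) (c : β → Fin k)
    (hl : l.Pairwise (fun p q => c p < c q)) (xb : Fin k → List α) (z : β → List α)
    (h : ∀ b, (z b).Sublist (xb (c b))) :
    ((l.map z).flatten).Sublist (List.ofFn xb).flatten := by
  refine (flatten_map_sub l z (fun b => xb (c b)) h).trans ?_
  have h1 : (l.map c).Pairwise (· < ·) := List.pairwise_map.2 hl
  have h2 : (l.map c).Sublist (List.finRange k) := by
    apply List.sublist_of_subperm_of_pairwise (r := (· < ·)) _ h1 (List.pairwise_lt_finRange k)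
    exact List.subperm_of_subset (h1.imp (fun h => ne_of_lt h)) (fun x _ => List.mem_finRange x)
  have h3 := (h2.map xb).flatten
  rw [List.ofFn_eq_map]
  simpa [Function.comp_def] using h3

/-- The total LCS along any block sequence is at most the LCS of the whole strings. -/
theorem blockSeq_lcs_le {α : Type*} (k : ℕ) (xb yb : Fin k → List α)
    (x y : List α) (hx : x = (List.ofFn xb).flatten) (hy : y = (List.ofFn yb).flatten)
    (S : Finset (Fin k × Fin k)) (hS : BlockSeq S) :
    ∑ p ∈ S, lcs (xb p.1) (yb p.2) ≤ lcs x y := by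
  obtain ⟨l, -, h2, h3⟩ := blockSeq_list S hS
  choose z hz hzx hzy using fun p : Fin k × Fin k => lcs_exists (xb p.1) (yb p.2)
  rw [h3]
  refine le_csSup (lcs_bdd x y) ⟨(l.map z).flatten, ?_, ?_, ?_⟩
  · simp [List.length_flatten, Function.comp_def, hz]
  · rw [hx]; exact sub_blocks l Prod.fst (h2.imp And.left) xb z hzx
  · rw [hy]; exact sub_blocks l Prod.snd (h2.imp And.right) yb z hzy
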